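/- arXiv:2306.15729 — 3 statements merged into one kernel-verified Lean document; each statement's English description precedes it below -/
import Mathlib

section
/- Let d ≥ 3, γ ∈ (−d, 0), 1 < p < d/(d+γ), and k ≥ 0. Then there exists a constant C > 0 depending only on d, γ, p, k such that for every nonnegative measurable function f on ℝ^d (for which all quantities below are finite): (d−1)(d+γ) ∫_{ℝ^d} ∫_{|v−w|≤1} |v−w|^γ f(w) ⟨v⟩^k f(v)^p dw dv ≤ C ‖f‖_{L^{d/(d+γ)}} ∫_{ℝ^d} ⟨v⟩^k f(v)^p dv. Equivalently, with c̄_γ[f](v) = −(d−1)(d+γ)∫_{|v−w|≤1}|v−w|^γ f(w) dw, one has −∫_{ℝ^d} ⟨v⟩^k c̄_γ[f](v) f(v)^p dv ≤ C ‖f‖_{L^{d/(d+γ)}} ∫_{ℝ^d} ⟨v⟩^k f(v)^p dv. -/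
open MeasureTheory Real Set Function
open scoped ENNReal NNReal RealInnerProductSpace

noncomputable section

/-- The velocity space `ℝ^d`. -/
abbrev V (d : ℕ) := EuclideanSpace ℝ (Fin d)

/-- Japanese bracket `⟨v⟩ = √(1+|v|²)`. -/
def jb {d : ℕ} (v : V d) : ℝ := Real.sqrt (1 + ‖v‖ ^ 2)

/-- Bilinear form of the Landau kernel `a(z) = |z|^{γ+2}(Id − z⊗z/|z|²)`. -/
def aBF {d : ℕ} (γ : ℝ) (z ξ η : V d) : ℝ :=
  ‖z‖ ^ (γ + 2) * (⟪ξ, η⟫ - ⟪z, ξ⟫ * ⟪z, η⟫ / ‖z‖ ^ 2)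

/-- Quadratic form of the Landau kernel `a(z)`. -/
def aQF {d : ℕ} (γ : ℝ) (z ξ : V d) : ℝ := aBF γ z ξ ξ

/-- The quadratic form of the matrix `A[g] = a ∗ g` (entrywise convolution). -/
def Aconv {d : ℕ} (γ : ℝ) (g : V d → ℝ) (v ξ η : V d) : ℝ :=
  ∫ w : V d, aBF γ (v - w) ξ η * g w

/-- Surface measure of the unit sphere `S^{d-1}` in `ℝ^d`. -/
def sphArea (d : ℕ) : ℝ := 2 * Real.pi ^ ((d : ℝ) / 2) / Real.Gamma ((d : ℝ) / 2)

/-- The coefficient `c_σ[g]` for `σ ∈ (−d, 0)`. -/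
def cConv (d : ℕ) (σ : ℝ) (g : V d → ℝ) (v : V d) : ℝ :=
  -((d : ℝ) - 1) * (σ + d) * ∫ w : V d, ‖v - w‖ ^ σ * g w

/-- The coefficient `c_σ[g]`, including the Coulomb case `σ = −d` where
`c_{-d}[g] = −(d−1)(d−2)|S^{d−1}| g`. -/
def cCoef (d : ℕ) (σ : ℝ) (g : V d → ℝ) (v : V d) : ℝ :=
  if σ = -(d : ℝ) then -((d : ℝ) - 1) * ((d : ℝ) - 2) * sphArea d * g v
  else cConv d σ g v

/-- Truncated (short-range) coefficient `c̄_γ[g]`. -/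
def cConvTrunc (d : ℕ) (γ : ℝ) (g : V d → ℝ) (v : V d) : ℝ :=
  -((d : ℝ) - 1) * (γ + d) * ∫ w in {w : V d | ‖v - w‖ ≤ 1}, ‖v - w‖ ^ γ * g w

/-- Level-set truncation `f_ℓ⁺(t,v) = (f(t,v) − ℓ)·1_{f ≥ ℓ}` of a time-dependent function. -/
def lvl {d : ℕ} (f : ℝ → V d → ℝ) (ℓ t : ℝ) (v : V d) : ℝ := max (f t v - ℓ) 0

/-- Level-set truncation `f_ℓ⁺ = (f − ℓ)·1_{f ≥ ℓ}` of a static function. -/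
def slvl {d : ℕ} (f : V d → ℝ) (ℓ : ℝ) (v : V d) : ℝ := max (f v - ℓ) 0

/-- Weighted moment `m_k(g) = ∫ g ⟨v⟩^k`. -/
def mom {d : ℕ} (k : ℝ) (g : V d → ℝ) : ℝ := ∫ v : V d, g v * jb v ^ k

/-- Weighted `L^p` functional `M_{k,p}(g) = ∫ g^p ⟨v⟩^k`. -/
def Mkp {d : ℕ} (k p : ℝ) (g : V d → ℝ) : ℝ := ∫ v : V d, g v ^ p * jb v ^ k

/-- Weighted dissipation functional `D_{k,p}(g) = ∫ |∇(⟨v⟩^{k/2} g^{p/2})|²`. -/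
def Dkp {d : ℕ} (k p : ℝ) (g : V d → ℝ) : ℝ :=
  ∫ v : V d, ‖gradient (fun w : V d => jb w ^ (k / 2) * g w ^ (p / 2)) v‖ ^ 2

/-- Definition 2.1: `(fin, f)` is an (H-)solution of the spatially homogeneous Landau
equation with parameter `γ` on the time interval `[0,T)`. -/
structure IsLandauSolution {d : ℕ} (γ T : ℝ) (fin : V d → ℝ) (f : ℝ → V d → ℝ) : Prop where
  fin_meas : Measurable fin
  fin_nonneg : ∀ v, 0 ≤ fin v
  fin_mass_energy : Integrable (fun v : V d => fin v * jb v ^ (2 : ℝ))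
  fin_entropy : Integrable (fun v : V d => fin v * Real.log (fin v))
  mass_pos : 0 < ∫ v : V d, fin v
  zero_momentum : (∫ v : V d, fin v • v) = (0 : V d)
  f_meas : Measurable (Function.uncurry f)
  f_nonneg : ∀ t v, 0 ≤ f t v
  f_cont : ∀ φ : V d → ℝ, ContDiff ℝ 2 φ → HasCompactSupport φ →
    ContinuousOn (fun t => ∫ v : V d, f t v * φ v) (Set.Ico 0 T)
  f_int : IntegrableOn (fun z : ℝ × V d => f z.1 z.2 * jb z.2 ^ (-1 : ℝ))
    (Set.Ioo 0 T ×ˢ (Set.univ : Set (V d)))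
  mass_conserved : ∀ t ∈ Set.Ico (0 : ℝ) T, (∫ v : V d, f t v) = ∫ v : V d, fin v
  momentum_conserved : ∀ t ∈ Set.Ico (0 : ℝ) T, (∫ v : V d, f t v • v) = (0 : V d)
  energy_conserved : ∀ t ∈ Set.Ico (0 : ℝ) T,
    (∫ v : V d, f t v * ‖v‖ ^ 2) = ∫ v : V d, fin v * ‖v‖ ^ 2
  entropy_decreasing : ∀ t ∈ Set.Ico (0 : ℝ) T,
    (∫ v : V d, f t v * Real.log (f t v)) ≤ ∫ v : V d, fin v * Real.log (fin v)
  field_L2 : (∫⁻ z : ℝ × V d × V d in Set.Ioo 0 T ×ˢ (Set.univ : Set (V d × V d)),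
    ENNReal.ofReal (f z.1 z.2.1 * f z.1 z.2.2 *
      aQF γ (z.2.1 - z.2.2)
        (gradient (fun x : V d => Real.log (f z.1 x)) z.2.1 -
         gradient (fun x : V d => Real.log (f z.1 x)) z.2.2))) < ⊤
  weak_form : ∀ φ : ℝ → V d → ℝ,
    ContDiff ℝ 2 (Function.uncurry φ) →
    HasCompactSupport (Function.uncurry φ) →
    tsupport (Function.uncurry φ) ⊆ Set.Ico 0 T ×ˢ (Set.univ : Set (V d)) →
    (∫ t in Set.Ioo (0 : ℝ) T, ∫ v : V d, f t v * deriv (fun s => φ s v) t)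
        + (∫ v : V d, fin v * φ 0 v)
      = ∫ t in Set.Ioo (0 : ℝ) T, ∫ v : V d, ∫ w : V d,
          f t v * f t w *
          aBF γ (v - w)
            (gradient (fun x : V d => Real.log (f t x)) v -
             gradient (fun x : V d => Real.log (f t x)) w)
            (gradient (φ t) v - gradient (φ t) w)

section RieszKernel

variable {E : Type*} [NormedAddCommGroup E] [NormedSpace ℝ E] [FiniteDimensional ℝ E]
  [MeasurableSpace E] [BorelSpace E] (μ : Measure E) [μ.IsAddHaarMeasure]

lemma integrable_norm_rpow_piecewise [Nontrivial E] {a b : ℝ}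
    (ha : -(Module.finrank ℝ E : ℝ) < a) (hb : b < -(Module.finrank ℝ E : ℝ)) :
    Integrable (fun x : E => if ‖x‖ < 1 then ‖x‖ ^ a else ‖x‖ ^ b) μ := by
  have hpos : 1 ≤ Module.finrank ℝ E := Module.finrank_pos
  have hmul : ∀ (s y : ℝ), 0 < y →
      y ^ ((Module.finrank ℝ E : ℝ) - 1 + s) = y ^ (Module.finrank ℝ E - 1) * y ^ s := by
    intro s y hy
    rw [rpow_add hy, ← rpow_natCast, Nat.cast_sub hpos, Nat.cast_one]
  refine (integrable_fun_norm_addHaar μ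
    (f := fun y : ℝ => if y < 1 then y ^ a else y ^ b)).2 ?_
  rw [← Ioo_union_Ici_eq_Ioi (zero_lt_one (α := ℝ))]
  refine IntegrableOn.union ?_ ?_
  · refine ((intervalIntegral.integrableOn_Ioo_rpow_iff
      (s := (Module.finrank ℝ E : ℝ) - 1 + a) zero_lt_one).2 (by linarith)).congr_fun ?_
      measurableSet_Ioo
    intro y hy
    simp [hy.2, hmul a y hy.1]
  · rw [integrableOn_Ici_iff_integrableOn_Ioi]
    refine (integrableOn_Ioi_rpow_of_lt
      (a := (Module.finrank ℝ E : ℝ) - 1 + b) (by linarith) zero_lt_one).congr_fun ?_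
      measurableSet_Ioi
    intro y hy
    simp [not_lt.2 (le_of_lt (mem_Ioi.1 hy)), hmul b y (zero_lt_one.trans hy)]

/-- Normalised form of the `L^∞`–`L^q` bound for the Riesz potential of order `γ`. -/
lemma exists_lintegral_mul_norm_rpow_le_of_le_one [Nontrivial E] {γ q : ℝ}
    (hγ : -(Module.finrank ℝ E : ℝ) < γ) (hq : 1 < q)
    (hγq : q * ((Module.finrank ℝ E + γ) / Module.finrank ℝ E) < 1) :
    ∃ C : ℝ≥0∞, C ≠ ∞ ∧ ∀ h : E → ℝ≥0∞, Measurable h → (∀ x, h x ≤ 1) →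
      ∫⁻ x, h x ^ q ∂μ ≤ 1 → ∫⁻ x, h x * ENNReal.ofReal (‖x‖ ^ γ) ∂μ ≤ C := by
  have hd : (0 : ℝ) < Module.finrank ℝ E := by exact_mod_cast Module.finrank_pos
  have hconj := Real.HolderConjugate.conjExponent hq
  set q' := q.conjExponent with hq'
  have hb : γ * q' < -(Module.finrank ℝ E : ℝ) := by
    rw [hq', Real.conjExponent, ← mul_div_assoc, div_lt_iff₀ (by linarith)]
    rw [← mul_div_assoc, div_lt_one hd] at hγq
    linarith
  have hint := integrable_norm_rpow_piecewise μ hγ hb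
  refine ⟨∫⁻ x, ENNReal.ofReal (if ‖x‖ < 1 then ‖x‖ ^ γ else ‖x‖ ^ (γ * q')) ∂μ + 1, ?_, ?_⟩
  · refine ENNReal.add_ne_top.2 ⟨?_, ENNReal.one_ne_top⟩
    exact hint.lintegral_lt_top.ne
  intro h hm h1 hN
  calc ∫⁻ x, h x * ENNReal.ofReal (‖x‖ ^ γ) ∂μ
      ≤ ∫⁻ x, (ENNReal.ofReal (if ‖x‖ < 1 then ‖x‖ ^ γ else ‖x‖ ^ (γ * q')) + h x ^ q) ∂μ := by
        refine lintegral_mono fun x => ?_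
        split_ifs with hx
        · calc h x * ENNReal.ofReal (‖x‖ ^ γ) ≤ 1 * ENNReal.ofReal (‖x‖ ^ γ) := by
                gcongr; exact h1 x
            _ ≤ _ := by rw [one_mul]; exact le_self_add
        · refine (ENNReal.young_inequality _ _ hconj).trans ?_
          rw [add_comm, ENNReal.ofReal_rpow_of_nonneg (by positivity) hconj.symm.nonneg,
            ← rpow_mul (norm_nonneg x)]
          have hle : ∀ (y : ℝ≥0∞) {t : ℝ}, 1 < t → y / ENNReal.ofReal t ≤ y := fun y t ht =>
            ENNReal.div_le_of_le_mul (by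
              calc y = y * 1 := (mul_one y).symm
                _ ≤ _ := by gcongr; simpa using ht.le)
          exact add_le_add (hle _ hconj.symm.lt) (hle _ hq)
    _ = ∫⁻ x, ENNReal.ofReal (if ‖x‖ < 1 then ‖x‖ ^ γ else ‖x‖ ^ (γ * q')) ∂μ
        + ∫⁻ x, h x ^ q ∂μ := lintegral_add_right _ (hm.pow_const q)
    _ ≤ _ := by gcongr

lemma lintegral_comp_smul_addHaar {g : E → ℝ≥0∞} (hg : Measurable g) {R : ℝ} (hR : 0 < R) :
    ∫⁻ x, g (R • x) ∂μ = ENNReal.ofReal (R ^ Module.finrank ℝ E)⁻¹ * ∫⁻ x, g x ∂μ := by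
  rw [← lintegral_map hg (measurable_const_smul R), Measure.map_addHaar_smul μ hR.ne',
    lintegral_smul_measure, abs_of_pos (by positivity), smul_eq_mul]

/-- The `L^∞`–`L^q` bound for the Riesz potential of order `γ`, subcritical `q`. -/
lemma exists_lintegral_mul_norm_sub_rpow_le [Nontrivial E] {γ q : ℝ}
    (hγ : -(Module.finrank ℝ E : ℝ) < γ) (hq : 1 < q)
    (hγq : q * ((Module.finrank ℝ E + γ) / Module.finrank ℝ E) < 1) :
    ∃ C : ℝ≥0∞, C ≠ ∞ ∧ ∀ (h : E → ℝ≥0∞) (v : E) (τ N : ℝ), Measurable h → 0 ≤ τ → 0 ≤ N →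
      (∀ x, h x ≤ ENNReal.ofReal τ) → ∫⁻ x, h x ^ q ∂μ ≤ ENNReal.ofReal N →
      ∫⁻ x, h x * ENNReal.ofReal (‖x - v‖ ^ γ) ∂μ ≤
        C * ENNReal.ofReal (τ ^ (1 - q * ((Module.finrank ℝ E + γ) / Module.finrank ℝ E)) *
          N ^ ((Module.finrank ℝ E + γ) / Module.finrank ℝ E)) := by
  obtain ⟨C, hC, hCb⟩ := exists_lintegral_mul_norm_rpow_le_of_le_one μ hγ hq hγq
  refine ⟨C, hC, fun h v τ N hm hτ hN hhτ hhN => ?_⟩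
  have hq0 : 0 < q := by linarith
  rcases hτ.eq_or_lt with rfl | hτ
  · have : ∀ x, h x = 0 := fun x => by simpa using hhτ x
    simp [this]
  rcases hN.eq_or_lt with rfl | hN
  · have h0 : ∀ᵐ x ∂μ, h x * ENNReal.ofReal (‖x - v‖ ^ γ) = 0 := by
      have := (lintegral_eq_zero_iff (hm.pow_const q)).1 (by simpa using hhN)
      filter_upwards [this] with x hx
      have : h x = 0 := by simpa [hq0, hq0.not_gt] using hx
      simp [this]
    rw [lintegral_congr_ae h0]
    simp
  set n := Module.finrank ℝ E with hn
  have hd : (0 : ℝ) < n := by exact_mod_cast Module.finrank_pos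
  set R : ℝ := (N / τ ^ q) ^ (1 / (n : ℝ)) with hR
  have hR0 : 0 < R := by positivity
  have hRn : R ^ n = N / τ ^ q := by
    rw [hR, ← rpow_natCast, ← rpow_mul (by positivity), one_div_mul_cancel hd.ne', rpow_one]
  set H : E → ℝ≥0∞ := fun x => ENNReal.ofReal τ⁻¹ * h (v + x) with hH
  have hHm : Measurable H := (hm.comp (measurable_const_add v)).const_mul _
  have key := hCb (fun x => H (R • x)) (hHm.comp (measurable_const_smul R)) (fun x => ?_) ?_
  · have hscale : ∀ x : E, H (R • x) * ENNReal.ofReal (‖x‖ ^ γ) =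
        ENNReal.ofReal (R ^ (-γ)) * (H (R • x) * ENNReal.ofReal (‖R • x‖ ^ γ)) := by
      intro x
      rw [mul_left_comm, ← ENNReal.ofReal_mul (by positivity), norm_smul,
        Real.norm_of_nonneg hR0.le, mul_rpow hR0.le (norm_nonneg x), ← mul_assoc,
        ← rpow_add hR0, neg_add_cancel, rpow_zero, one_mul]
    have hKm : Measurable fun x : E => ENNReal.ofReal (‖x‖ ^ γ) :=
      (measurable_norm.pow_const γ).ennreal_ofReal
    simp_rw [hscale] at key
    rw [lintegral_const_mul' _ _ ENNReal.ofReal_ne_top,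
      lintegral_comp_smul_addHaar μ (g := fun x => H x * ENNReal.ofReal (‖x‖ ^ γ))
        (hHm.mul hKm) hR0] at key
    simp_rw [hH, mul_assoc] at key
    rw [lintegral_const_mul' _ _ ENNReal.ofReal_ne_top,
      ← mul_assoc, ← mul_assoc, ← ENNReal.ofReal_mul (by positivity),
      ← ENNReal.ofReal_mul (by positivity)] at key
    have hshift : ∫⁻ x, h x * ENNReal.ofReal (‖x - v‖ ^ γ) ∂μ =
        ∫⁻ x, h (v + x) * ENNReal.ofReal (‖x‖ ^ γ) ∂μ := by
      rw [← lintegral_add_left_eq_self (fun x => h x * ENNReal.ofReal (‖x - v‖ ^ γ)) v]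
      simp
    rw [hshift]
    set c : ℝ := R ^ (-γ) * (R ^ n)⁻¹ * τ⁻¹ with hc
    have hc0 : 0 < c := by positivity
    have hcinv : τ ^ (1 - q * ((n + γ) / n)) * N ^ ((n + γ) / n) = c⁻¹ := by
      have h1 : R ^ γ = (N / τ ^ q) ^ (γ / n) := by
        rw [hR, ← rpow_mul (by positivity)]; congr 1; ring
      have h2 : ((n : ℝ) + γ) / n = 1 + γ / n := by field_simp
      rw [hc, mul_inv, mul_inv, inv_inv, inv_inv, rpow_neg hR0.le, inv_inv, hRn, h1, h2,
        ← rpow_add_one (by positivity), add_comm (γ / n), div_rpow hN.le (by positivity),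
        rpow_sub hτ, rpow_one, rpow_mul hτ.le]
      ring
    rw [hcinv]
    calc _ = ENNReal.ofReal c⁻¹ *
          (ENNReal.ofReal c * ∫⁻ x, h (v + x) * ENNReal.ofReal (‖x‖ ^ γ) ∂μ) := by
          rw [← mul_assoc, ← ENNReal.ofReal_mul (by positivity), inv_mul_cancel₀ hc0.ne',
            ENNReal.ofReal_one, one_mul]
      _ ≤ ENNReal.ofReal c⁻¹ * C := by gcongr
      _ = _ := mul_comm _ _
  · calc H (R • x) ≤ ENNReal.ofReal τ⁻¹ * ENNReal.ofReal τ := by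
          simp only [hH]; gcongr; exact hhτ _
      _ = 1 := by
          rw [← ENNReal.ofReal_mul (by positivity), inv_mul_cancel₀ hτ.ne', ENNReal.ofReal_one]
  · rw [lintegral_comp_smul_addHaar μ (hHm.pow_const q) hR0]
    simp_rw [hH, ENNReal.mul_rpow_of_nonneg _ _ hq0.le]
    rw [lintegral_const_mul' _ _ (ENNReal.rpow_ne_top_of_nonneg hq0.le ENNReal.ofReal_ne_top),
      lintegral_add_left_eq_self (fun x => h x ^ q) v, ← mul_assoc,
      ENNReal.ofReal_rpow_of_nonneg (by positivity) hq0.le,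
      ← ENNReal.ofReal_mul (by positivity)]
    calc _ ≤ ENNReal.ofReal ((R ^ n)⁻¹ * τ⁻¹ ^ q) * ENNReal.ofReal N := by gcongr
      _ = 1 := by
        rw [← ENNReal.ofReal_mul (by positivity), hRn, inv_rpow hτ.le]
        rw [show (N / τ ^ q)⁻¹ * (τ ^ q)⁻¹ * N = 1 by field_simp, ENNReal.ofReal_one]

end RieszKernel

lemma jb_pos {d : ℕ} (v : V d) : 0 < jb v := Real.sqrt_pos.2 (by positivity)

@[fun_prop]
lemma measurable_jb {d : ℕ} : Measurable (jb : V d → ℝ) := by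
  unfold jb
  fun_prop

/-- Peetre's inequality for points at distance at most one. -/
lemma jb_rpow_le_of_norm_sub_le_one {d : ℕ} {k : ℝ} (hk : 0 ≤ k) {v w : V d}
    (h : ‖v - w‖ ≤ 1) : jb v ^ k ≤ √3 ^ k * jb w ^ k := by
  rw [← mul_rpow (by positivity) (jb_pos w).le]
  refine rpow_le_rpow (jb_pos v).le ?_ hk
  unfold jb
  rw [← Real.sqrt_mul (by norm_num)]
  refine Real.sqrt_le_sqrt ?_
  have h1 : ‖v‖ ≤ ‖w‖ + 1 := by linarith [norm_le_norm_add_norm_sub' v w]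
  nlinarith [norm_nonneg v, norm_nonneg w, sq_nonneg (‖w‖ - 1)]

/-- The part of `∬_{|v-w| ≤ 1} |v-w|^γ f(w) ⟨v⟩^k f(v)^p` where `f(w) ≤ f(v)`. -/
lemma exists_lintegral_truncated_le_of_le (d : ℕ) (hd : 0 < d) (γ : ℝ) (hγ₁ : -(d : ℝ) < γ)
    (hγ₂ : γ < 0) (p : ℝ) (hp₁ : 1 < p) (hp₂ : p < (d : ℝ) / (d + γ)) (k : ℝ) (hk : 0 ≤ k) :
    ∃ C : ℝ≥0∞, C ≠ ∞ ∧ ∀ f : V d → ℝ, Measurable f → (∀ v, 0 ≤ f v) →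
      Integrable (fun v : V d => f v ^ ((d : ℝ) / (d + γ))) →
      Integrable (fun v : V d => jb v ^ k * f v ^ p) →
      ∫⁻ v, ENNReal.ofReal (jb v ^ k * f v ^ p) *
        (∫⁻ w, {w | f w ≤ f v ∧ ‖v - w‖ ≤ 1}.indicator (fun w => ENNReal.ofReal (f w)) w *
          ENNReal.ofReal (‖w - v‖ ^ γ)) ≤
      C * ENNReal.ofReal ((∫ v : V d, f v ^ ((d : ℝ) / (d + γ))) ^ (((d : ℝ) + γ) / d)
            * ∫ v : V d, jb v ^ k * f v ^ p) := by
  have hd0 : (0 : ℝ) < d := by exact_mod_cast hd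
  have hdγ : (0 : ℝ) < d + γ := by linarith
  have : Nonempty (Fin d) := ⟨⟨0, hd⟩⟩
  set θ : ℝ := ((d : ℝ) + γ) / d with hθ
  have hθ0 : 0 < θ := by positivity
  have hθ1 : θ < 1 := by rw [hθ, div_lt_one hd0]; linarith
  have hr : (d : ℝ) / (d + γ) = θ⁻¹ := by rw [hθ, inv_div]
  rw [hr] at hp₂ ⊢
  have hpθ : p * θ < 1 := by rwa [lt_inv_comm₀ (by linarith) hθ0, lt_inv_comm₀ hθ0 (by linarith),
    ← one_div, lt_div_iff₀ hθ0] at hp₂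
  obtain ⟨C, hC, hCb⟩ := exists_lintegral_mul_norm_sub_rpow_le (E := V d) volume (γ := γ) (q := p)
    (by simpa using hγ₁) hp₁ (by simpa using hpθ)
  simp only [finrank_euclideanSpace_fin, ← hθ] at hCb
  refine ⟨C * ENNReal.ofReal ((√3 ^ k) ^ θ), ENNReal.mul_ne_top hC ENNReal.ofReal_ne_top,
    fun f hf hf0 hfr hfp => ?_⟩
  set A : ℝ := ∫ v : V d, f v ^ θ⁻¹ with hA
  set M : ℝ := ∫ v : V d, jb v ^ k * f v ^ p with hM
  have hmp : ∀ v, 0 ≤ jb v ^ k * f v ^ p := fun v =>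
    mul_nonneg (rpow_nonneg (jb_pos v).le _) (rpow_nonneg (hf0 v) _)
  have hA0 : 0 ≤ A := integral_nonneg fun v => rpow_nonneg (hf0 v) _
  have hM0 : 0 ≤ M := integral_nonneg hmp
  have hAl := ofReal_integral_eq_lintegral_ofReal hfr (.of_forall fun v => rpow_nonneg (hf0 v) _)
  have hMl := ofReal_integral_eq_lintegral_ofReal hfp (.of_forall hmp)
  rw [← hA] at hAl
  rw [← hM] at hMl
  clear_value A M
  have inner : ∀ v, ∫⁻ w, {w | f w ≤ f v ∧ ‖v - w‖ ≤ 1}.indicator (fun w => ENNReal.ofReal (f w)) w *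
          ENNReal.ofReal (‖w - v‖ ^ γ) ≤
      C * ENNReal.ofReal (f v ^ (1 - p * θ) * (√3 ^ k * (jb v ^ k)⁻¹ * M) ^ θ) := by
    intro v
    have hj := rpow_pos_of_pos (jb_pos v) k
    have hS : MeasurableSet {w | f w ≤ f v ∧ ‖v - w‖ ≤ 1} :=
      (measurableSet_le hf measurable_const).inter
        (measurableSet_le (by fun_prop : Measurable fun w => ‖v - w‖) measurable_const)
    refine hCb ({w | f w ≤ f v ∧ ‖v - w‖ ≤ 1}.indicator fun w => ENNReal.ofReal (f w)) v (f v)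
      (√3 ^ k * (jb v ^ k)⁻¹ * M) (hf.ennreal_ofReal.indicator hS) (hf0 v) (by positivity) ?_ ?_
    · intro w
      refine indicator_apply_le' (fun hw => ENNReal.ofReal_le_ofReal hw.1) fun _ => zero_le
    · rw [ENNReal.ofReal_mul (by positivity), hMl, ← lintegral_const_mul' _ _ ENNReal.ofReal_ne_top]
      refine lintegral_mono fun w => ?_
      by_cases hw : w ∈ {w | f w ≤ f v ∧ ‖v - w‖ ≤ 1}
      · rw [indicator_of_mem hw, ENNReal.ofReal_rpow_of_nonneg (hf0 w) (by linarith),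
          ← ENNReal.ofReal_mul (by positivity)]
        refine ENNReal.ofReal_le_ofReal ?_
        have h1 := jb_rpow_le_of_norm_sub_le_one hk hw.2
        have h2 : 1 ≤ √3 ^ k * (jb v ^ k)⁻¹ * jb w ^ k := by
          rw [mul_right_comm, ← div_eq_mul_inv, one_le_div hj]; exact h1
        calc f w ^ p = 1 * f w ^ p := (one_mul _).symm
          _ ≤ (√3 ^ k * (jb v ^ k)⁻¹ * jb w ^ k) * f w ^ p := by
            gcongr; exact rpow_nonneg (hf0 w) _
          _ = _ := by ring
      · rw [indicator_of_notMem hw, ENNReal.zero_rpow_of_pos (by linarith)]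
        exact zero_le
  have point : ∀ v, jb v ^ k * f v ^ p * (f v ^ (1 - p * θ) * (√3 ^ k * (jb v ^ k)⁻¹ * M) ^ θ) =
      (√3 ^ k) ^ θ * M ^ θ * ((jb v ^ k * f v ^ p) ^ (1 - θ) * (f v ^ θ⁻¹) ^ θ) := by
    intro v
    have hj := rpow_pos_of_pos (jb_pos v) k
    rw [← rpow_mul (hf0 v), inv_mul_cancel₀ hθ0.ne', rpow_one,
      mul_rpow (by positivity) hM0, mul_rpow (by positivity) (by positivity), inv_rpow hj.le]
    rcases (hf0 v).eq_or_lt with h0 | h0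
    · rw [← h0, zero_rpow (by linarith)]; simp
    · rw [mul_rpow hj.le (by positivity), rpow_sub hj, rpow_one, ← rpow_mul h0.le,
        show p * (1 - θ) = p - p * θ by ring, rpow_sub h0, rpow_sub h0, rpow_one]
      ring
  calc _ ≤ ∫⁻ v, ENNReal.ofReal (jb v ^ k * f v ^ p) *
        (C * ENNReal.ofReal (f v ^ (1 - p * θ) * (√3 ^ k * (jb v ^ k)⁻¹ * M) ^ θ)) := by
        gcongr with v; exact inner v
    _ = ∫⁻ v, C * ENNReal.ofReal ((√3 ^ k) ^ θ * M ^ θ) *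
        (ENNReal.ofReal (jb v ^ k * f v ^ p) ^ (1 - θ) * ENNReal.ofReal (f v ^ θ⁻¹) ^ θ) := by
        refine lintegral_congr fun v => ?_
        rw [mul_left_comm, ← ENNReal.ofReal_mul (hmp v), point,
          ENNReal.ofReal_mul (by positivity),
          ENNReal.ofReal_mul (rpow_nonneg (hmp v) _),
          ENNReal.ofReal_rpow_of_nonneg (hmp v) (by linarith),
          ENNReal.ofReal_rpow_of_nonneg (rpow_nonneg (hf0 v) _) hθ0.le]
        ring
    _ = C * ENNReal.ofReal ((√3 ^ k) ^ θ * M ^ θ) * ∫⁻ v,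
        ENNReal.ofReal (jb v ^ k * f v ^ p) ^ (1 - θ) * ENNReal.ofReal (f v ^ θ⁻¹) ^ θ :=
        lintegral_const_mul' _ _ (ENNReal.mul_ne_top hC ENNReal.ofReal_ne_top)
    _ ≤ C * ENNReal.ofReal ((√3 ^ k) ^ θ * M ^ θ) *
        (ENNReal.ofReal M ^ (1 - θ) * ENNReal.ofReal A ^ θ) := by
        rw [hMl, hAl]
        gcongr
        exact ENNReal.lintegral_mul_norm_pow_le (by fun_prop) (by fun_prop) (by linarith)
          hθ0.le (by ring)
    _ = _ := by
        rw [ENNReal.ofReal_rpow_of_nonneg hM0 (by linarith),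
          ENNReal.ofReal_rpow_of_nonneg hA0 hθ0.le, mul_assoc, mul_assoc,
          ← ENNReal.ofReal_mul (by positivity), ← ENNReal.ofReal_mul (by positivity),
          ← ENNReal.ofReal_mul (by positivity)]
        congr 2
        rcases hM0.eq_or_lt with h0 | h0
        · rw [← h0, zero_rpow hθ0.ne']; simp
        · rw [rpow_sub h0, rpow_one]
          field_simp

/-- The part of `∬_{|v-w| ≤ 1} |v-w|^γ f(w) ⟨v⟩^k f(v)^p` where `f(v) ≤ f(w)`, with the
order of integration exchanged. -/
lemma exists_lintegral_truncated_le_of_ge (d : ℕ) (hd : 0 < d) (γ : ℝ) (hγ₁ : -(d : ℝ) < γ)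
    (p : ℝ) (hp₁ : 1 < p) (hp₂ : p < (d : ℝ) / (d + γ)) (k : ℝ) (hk : 0 ≤ k) :
    ∃ C : ℝ≥0∞, C ≠ ∞ ∧ ∀ f : V d → ℝ, Measurable f → (∀ v, 0 ≤ f v) →
      Integrable (fun v : V d => f v ^ ((d : ℝ) / (d + γ))) →
      Integrable (fun v : V d => jb v ^ k * f v ^ p) →
      ∫⁻ w, ENNReal.ofReal (f w) * (∫⁻ v, {v | f v ≤ f w ∧ ‖v - w‖ ≤ 1}.indicator
          (fun v => ENNReal.ofReal (jb v ^ k * f v ^ p)) v * ENNReal.ofReal (‖v - w‖ ^ γ)) ≤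
      C * ENNReal.ofReal ((∫ v : V d, f v ^ ((d : ℝ) / (d + γ))) ^ (((d : ℝ) + γ) / d)
            * ∫ v : V d, jb v ^ k * f v ^ p) := by
  have hd0 : (0 : ℝ) < d := by exact_mod_cast hd
  have hdγ : (0 : ℝ) < d + γ := by linarith
  have : Nonempty (Fin d) := ⟨⟨0, hd⟩⟩
  set θ : ℝ := ((d : ℝ) + γ) / d with hθ
  have hθ0 : 0 < θ := by positivity
  have hp0 : 0 < p := by linarith
  have hr : (d : ℝ) / (d + γ) = θ⁻¹ := by rw [hθ, inv_div]
  rw [hr] at hp₂ ⊢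
  have hqθ : θ⁻¹ / p * θ = p⁻¹ := by field_simp
  obtain ⟨C, hC, hCb⟩ := exists_lintegral_mul_norm_sub_rpow_le (E := V d) volume (γ := γ)
    (q := θ⁻¹ / p) (by simpa using hγ₁) ((one_lt_div hp0).2 hp₂)
    (by rw [finrank_euclideanSpace_fin, ← hθ, hqθ]; exact inv_lt_one_of_one_lt₀ hp₁)
  simp only [finrank_euclideanSpace_fin, ← hθ, hqθ] at hCb
  refine ⟨C * ENNReal.ofReal (√3 ^ k), ENNReal.mul_ne_top hC ENNReal.ofReal_ne_top,
    fun f hf hf0 hfr hfp => ?_⟩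
  set A : ℝ := ∫ v : V d, f v ^ θ⁻¹ with hA
  set M : ℝ := ∫ v : V d, jb v ^ k * f v ^ p with hM
  have hmp : ∀ v, 0 ≤ jb v ^ k * f v ^ p := fun v =>
    mul_nonneg (rpow_nonneg (jb_pos v).le _) (rpow_nonneg (hf0 v) _)
  have hA0 : 0 ≤ A := integral_nonneg fun v => rpow_nonneg (hf0 v) _
  have hAl := ofReal_integral_eq_lintegral_ofReal hfr (.of_forall fun v => rpow_nonneg (hf0 v) _)
  have hMl := ofReal_integral_eq_lintegral_ofReal hfp (.of_forall hmp)
  rw [← hA] at hAl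
  rw [← hM] at hMl
  clear_value A M
  have inner : ∀ w, ∫⁻ v, {v | f v ≤ f w ∧ ‖v - w‖ ≤ 1}.indicator
        (fun v => ENNReal.ofReal (jb v ^ k * f v ^ p)) v * ENNReal.ofReal (‖v - w‖ ^ γ) ≤
      ENNReal.ofReal (√3 ^ k * jb w ^ k) *
        (C * ENNReal.ofReal ((f w ^ p) ^ (1 - p⁻¹) * A ^ θ)) := by
    intro w
    have hj := rpow_pos_of_pos (jb_pos w) k
    have hS : MeasurableSet {v | f v ≤ f w ∧ ‖v - w‖ ≤ 1} :=
      (measurableSet_le hf measurable_const).inter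
        (measurableSet_le (by fun_prop : Measurable fun v => ‖v - w‖) measurable_const)
    have hlow := hCb ({v | f v ≤ f w ∧ ‖v - w‖ ≤ 1}.indicator fun v => ENNReal.ofReal (f v ^ p))
      w (f w ^ p) A ((hf.pow_const p).ennreal_ofReal.indicator hS) (rpow_nonneg (hf0 w) _) hA0 ?_ ?_
    · refine le_trans ?_ (mul_le_mul_right hlow _)
      rw [← lintegral_const_mul' _ _ ENNReal.ofReal_ne_top]
      refine lintegral_mono fun v => ?_
      rw [← mul_assoc]
      gcongr
      by_cases hv : v ∈ {v | f v ≤ f w ∧ ‖v - w‖ ≤ 1}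
      · rw [indicator_of_mem hv, indicator_of_mem hv, ← ENNReal.ofReal_mul (by positivity)]
        refine ENNReal.ofReal_le_ofReal ?_
        gcongr
        · exact rpow_nonneg (hf0 v) _
        · exact jb_rpow_le_of_norm_sub_le_one hk hv.2
      · simp [indicator_of_notMem hv]
    · intro v
      refine indicator_apply_le' (fun hv => ENNReal.ofReal_le_ofReal ?_) fun _ => zero_le
      exact rpow_le_rpow (hf0 v) hv.1 hp0.le
    · rw [hAl]
      refine lintegral_mono fun v => ?_
      by_cases hv : v ∈ {v | f v ≤ f w ∧ ‖v - w‖ ≤ 1}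
      · rw [indicator_of_mem hv, ENNReal.ofReal_rpow_of_nonneg (rpow_nonneg (hf0 v) _)
          (by positivity), ← rpow_mul (hf0 v), mul_div_cancel₀ _ hp0.ne']
      · rw [indicator_of_notMem hv, ENNReal.zero_rpow_of_pos (by positivity)]
        exact zero_le
  have point : ∀ w, f w * (√3 ^ k * jb w ^ k) * ((f w ^ p) ^ (1 - p⁻¹) * A ^ θ) =
      √3 ^ k * A ^ θ * (jb w ^ k * f w ^ p) := by
    intro w
    rcases (hf0 w).eq_or_lt with h0 | h0
    · rw [← h0, zero_rpow hp0.ne']; simp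
    · rw [← rpow_mul h0.le, show p * (1 - p⁻¹) = p - 1 by field_simp, rpow_sub h0, rpow_one]
      field_simp
  calc _ ≤ ∫⁻ w, ENNReal.ofReal (f w) * (ENNReal.ofReal (√3 ^ k * jb w ^ k) *
        (C * ENNReal.ofReal ((f w ^ p) ^ (1 - p⁻¹) * A ^ θ))) := by
        gcongr with w; exact inner w
    _ = ∫⁻ w, C * ENNReal.ofReal (√3 ^ k * A ^ θ) * ENNReal.ofReal (jb w ^ k * f w ^ p) := by
        refine lintegral_congr fun w => ?_
        have hj := rpow_pos_of_pos (jb_pos w) k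
        rw [mul_assoc C, ← ENNReal.ofReal_mul (by positivity), ← point,
          ENNReal.ofReal_mul (mul_nonneg (hf0 w) (by positivity)), ENNReal.ofReal_mul (hf0 w)]
        ring
    _ = C * ENNReal.ofReal (√3 ^ k * A ^ θ) * ENNReal.ofReal M := by
        rw [lintegral_const_mul' _ _ (ENNReal.mul_ne_top hC ENNReal.ofReal_ne_top), hMl]
    _ = _ := by
        rw [mul_assoc, mul_assoc, ← ENNReal.ofReal_mul (by positivity),
          ← ENNReal.ofReal_mul (by positivity), mul_assoc]

lemma ofReal_integral_le_lintegral_ofReal {α : Type*} [MeasurableSpace α] {μ : Measure α}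
    {g : α → ℝ} (hg : ∀ x, 0 ≤ g x) :
    ENNReal.ofReal (∫ x, g x ∂μ) ≤ ∫⁻ x, ENNReal.ofReal (g x) ∂μ := by
  by_cases h : Integrable g μ
  · exact (ofReal_integral_eq_lintegral_ofReal h (.of_forall hg)).le
  · simp [integral_undef h]

/-- key estimate in Proposition 3.4: for `d ≥ 3`, `γ ∈ (−d,0)`,
`1 < p < d/(d+γ)` and `k ≥ 0` there is `C > 0` depending only on `d, γ, p, k` such that
for every nonnegative measurable `f` (for which all the quantities are finite)
`−∫ ⟨v⟩^k c̄_γ[f](v) f(v)^p dv ≤ C ‖f‖_{L^{d/(d+γ)}} ∫ ⟨v⟩^k f(v)^p dv`. -/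
theorem truncated_coefficient_estimate
    (d : ℕ) (hd : 3 ≤ d) (γ : ℝ) (hγ₁ : -(d : ℝ) < γ) (hγ₂ : γ < 0)
    (p : ℝ) (hp₁ : 1 < p) (hp₂ : p < (d : ℝ) / (d + γ)) (k : ℝ) (hk : 0 ≤ k) :
    ∃ C : ℝ, 0 < C ∧
      ∀ f : V d → ℝ, Measurable f → (∀ v, 0 ≤ f v) →
        Integrable (fun v : V d => f v ^ ((d : ℝ) / (d + γ))) →
        Integrable (fun v : V d => jb v ^ k * f v ^ p) →
        Integrable (fun v : V d => jb v ^ k * (-cConvTrunc d γ f v) * f v ^ p) →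
        -(∫ v : V d, jb v ^ k * cConvTrunc d γ f v * f v ^ p)
          ≤ C * (∫ v : V d, f v ^ ((d : ℝ) / (d + γ))) ^ (((d : ℝ) + γ) / d)
            * ∫ v : V d, jb v ^ k * f v ^ p := by
  have hd0 : 0 < d := by omega
  have hd3 : (3 : ℝ) ≤ d := by exact_mod_cast hd
  obtain ⟨C₁, hC₁, h₁⟩ := exists_lintegral_truncated_le_of_le d hd0 γ hγ₁ hγ₂ p hp₁ hp₂ k hk
  obtain ⟨C₂, hC₂, h₂⟩ := exists_lintegral_truncated_le_of_ge d hd0 γ hγ₁ p hp₁ hp₂ k hk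
  set c : ℝ := ((d : ℝ) - 1) * (γ + d) with hc
  have hc0 : 0 < c := mul_pos (by linarith) (by linarith)
  refine ⟨c * ((C₁ + C₂).toReal + 1), by positivity, fun f hf hf0 hfr hfp _ => ?_⟩
  specialize h₁ f hf hf0 hfr hfp
  specialize h₂ f hf hf0 hfr hfp
  set X : ℝ := (∫ v : V d, f v ^ ((d : ℝ) / (d + γ))) ^ (((d : ℝ) + γ) / d)
            * ∫ v : V d, jb v ^ k * f v ^ p with hX
  have hmp : ∀ v, 0 ≤ jb v ^ k * f v ^ p := fun v =>
    mul_nonneg (rpow_nonneg (jb_pos v).le _) (rpow_nonneg (hf0 v) _)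
  have hX0 : 0 ≤ X := mul_nonneg
    (rpow_nonneg (integral_nonneg fun v => rpow_nonneg (hf0 v) _) _) (integral_nonneg hmp)
  have hK0 : ∀ v w : V d, 0 ≤ ‖v - w‖ ^ γ * f w := fun v w => mul_nonneg (by positivity) (hf0 w)
  set J : V d → ℝ := fun v => ∫ w in {w : V d | ‖v - w‖ ≤ 1}, ‖v - w‖ ^ γ * f w with hJ
  have hJ0 : ∀ v, 0 ≤ J v := fun v => integral_nonneg (hK0 v)
  have hLHS : -(∫ v : V d, jb v ^ k * cConvTrunc d γ f v * f v ^ p) =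
      c * ∫ v, jb v ^ k * f v ^ p * J v := by
    rw [← integral_neg, ← integral_const_mul]
    refine integral_congr_ae (.of_forall fun v => ?_)
    simp only [cConvTrunc, hc, hJ]
    ring
  set G₁ : V d → V d → ℝ≥0∞ := fun v w => ENNReal.ofReal (jb v ^ k * f v ^ p) *
    ({w | f w ≤ f v ∧ ‖v - w‖ ≤ 1}.indicator (fun w => ENNReal.ofReal (f w)) w *
      ENNReal.ofReal (‖w - v‖ ^ γ)) with hG₁
  set G₂ : V d → V d → ℝ≥0∞ := fun v w => ENNReal.ofReal (f w) *
    ({v | f v ≤ f w ∧ ‖v - w‖ ≤ 1}.indicator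
      (fun v => ENNReal.ofReal (jb v ^ k * f v ^ p)) v * ENNReal.ofReal (‖v - w‖ ^ γ)) with hG₂
  have hG₂m : Measurable (uncurry G₂) := by
    have hS : MeasurableSet {x : V d × V d | f x.1 ≤ f x.2 ∧ ‖x.1 - x.2‖ ≤ 1} :=
      (measurableSet_le (hf.comp measurable_fst) (hf.comp measurable_snd)).inter
        (measurableSet_le (by fun_prop : Measurable fun x : V d × V d => ‖x.1 - x.2‖)
          measurable_const)
    have hI : Measurable ({x : V d × V d | f x.1 ≤ f x.2 ∧ ‖x.1 - x.2‖ ≤ 1}.indicator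
        fun x => ENNReal.ofReal (jb x.1 ^ k * f x.1 ^ p)) :=
      Measurable.indicator (by fun_prop) hS
    have hN : Measurable fun x : V d × V d => ENNReal.ofReal (‖x.1 - x.2‖ ^ γ) := by fun_prop
    have hF : Measurable fun x : V d × V d => ENNReal.ofReal (f x.2) := by fun_prop
    exact hF.mul (hI.mul hN)
  have hI₁ : ∫⁻ v, ∫⁻ w, G₁ v w ≤ C₁ * ENNReal.ofReal X := by
    refine le_of_eq_of_le (lintegral_congr fun v => ?_) h₁
    exact lintegral_const_mul' _ _ ENNReal.ofReal_ne_top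
  have hI₂ : ∫⁻ v, ∫⁻ w, G₂ v w ≤ C₂ * ENNReal.ofReal X := by
    rw [lintegral_lintegral_swap hG₂m.aemeasurable]
    refine le_of_eq_of_le (lintegral_congr fun w => ?_) h₂
    exact lintegral_const_mul' _ _ ENNReal.ofReal_ne_top
  have hpt : ∀ v, ENNReal.ofReal (jb v ^ k * f v ^ p * J v) ≤ ∫⁻ w, (G₁ v w + G₂ v w) := by
    intro v
    have hB : MeasurableSet {w : V d | ‖v - w‖ ≤ 1} :=
      measurableSet_le (by fun_prop) measurable_const
    rw [ENNReal.ofReal_mul (hmp v)]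
    calc _ ≤ ENNReal.ofReal (jb v ^ k * f v ^ p) *
          ∫⁻ w in {w : V d | ‖v - w‖ ≤ 1}, ENNReal.ofReal (‖v - w‖ ^ γ * f w) := by
          gcongr
          exact ofReal_integral_le_lintegral_ofReal (hK0 v)
      _ = ∫⁻ w, ENNReal.ofReal (jb v ^ k * f v ^ p) * {w : V d | ‖v - w‖ ≤ 1}.indicator
          (fun w => ENNReal.ofReal (‖v - w‖ ^ γ * f w)) w := by
          rw [lintegral_const_mul' _ _ ENNReal.ofReal_ne_top, lintegral_indicator hB]
      _ ≤ _ := by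
          refine lintegral_mono fun w => ?_
          by_cases hw : ‖v - w‖ ≤ 1
          · rw [indicator_of_mem (by exact hw), ENNReal.ofReal_mul (rpow_nonneg (norm_nonneg _) γ)]
            rcases le_total (f w) (f v) with h | h
            · refine le_add_right (le_of_eq ?_)
              simp only [hG₁]
              rw [indicator_of_mem (by exact ⟨h, hw⟩), norm_sub_rev w v]
              ring
            · refine le_add_left (le_of_eq ?_)
              simp only [hG₂]
              rw [indicator_of_mem (by exact ⟨h, hw⟩)]
              ring
          · rw [indicator_of_notMem (by exact hw), mul_zero]
            exact zero_le
  have htot : ENNReal.ofReal (∫ v, jb v ^ k * f v ^ p * J v) ≤ (C₁ + C₂) * ENNReal.ofReal X := by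
    refine (ofReal_integral_le_lintegral_ofReal fun v => mul_nonneg (hmp v) (hJ0 v)).trans ?_
    refine (lintegral_mono hpt).trans ?_
    calc ∫⁻ v, ∫⁻ w, (G₁ v w + G₂ v w) = ∫⁻ v, ((∫⁻ w, G₁ v w) + ∫⁻ w, G₂ v w) :=
          lintegral_congr fun v => lintegral_add_right _ hG₂m.of_uncurry_left
      _ = (∫⁻ v, ∫⁻ w, G₁ v w) + ∫⁻ v, ∫⁻ w, G₂ v w :=
          lintegral_add_right _ hG₂m.lintegral_prod_right'
      _ ≤ _ := by rw [add_mul]; exact add_le_add hI₁ hI₂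
  have hreal : ∫ v, jb v ^ k * f v ^ p * J v ≤ (C₁ + C₂).toReal * X := by
    rw [← ENNReal.ofReal_toReal (ENNReal.add_ne_top.2 ⟨hC₁, hC₂⟩),
      ← ENNReal.ofReal_mul ENNReal.toReal_nonneg] at htot
    exact (ENNReal.ofReal_le_ofReal_iff (mul_nonneg ENNReal.toReal_nonneg hX0)).1 htot
  rw [hLHS, mul_assoc _ (_ ^ _), ← hX, mul_assoc c]
  gcongr
  linarith
end
end

section
/- Let d ≥ 1, γ ∈ (−d, 0), p ∈ (1, d/(d+γ)), and q > (p+1)d/(2d+γ). Then there exists C > 0 depending only on p, q, γ, d such that for every nonnegative measurable function f on ℝ^d and all 0 ≤ k < ℓ (whenever the quantities are defined): (i) −∫_{ℝ^d} c_γ[f_ℓ⁺](v) (f_ℓ⁺(v))^p dv ≤ C (ℓ−k)^{p+1−q(2d+γ)/d} ‖f_k⁺‖_q^{q(2d+γ)/d}; and (ii) −∫_{ℝ^d} c_γ[f_ℓ⁺](v) (f_ℓ⁺(v))^{p−1} dv ≤ C (ℓ−k)^{p−q(2d+γ)/d} ‖f_k⁺‖_q^{q(2d+γ)/d}. -/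
open MeasureTheory Real Set Function
open scoped ENNReal NNReal RealInnerProductSpace

noncomputable section

/-- The tail integral of a power, as a lower Lebesgue integral. -/
lemma lintegral_Ioi_rpow_of_lt {a c : ℝ} (ha : a < -1) (hc : 0 < c) :
    ∫⁻ t in Ioi c, ENNReal.ofReal (t ^ a) = ENNReal.ofReal (c ^ (a + 1) * (-(a + 1))⁻¹) := by
  rw [← ofReal_integral_eq_lintegral_ofReal (integrableOn_Ioi_rpow_of_lt ha hc),
    integral_Ioi_rpow_of_lt ha hc]
  · congr 1
    rw [inv_neg, div_eq_mul_inv]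
    ring
  · filter_upwards [ae_restrict_mem measurableSet_Ioi] with t ht
    exact rpow_nonneg (hc.trans ht).le _

/-- The integral of an integrable power near the origin, as a lower Lebesgue integral. -/
lemma lintegral_Ioc_rpow {a c : ℝ} (ha : -1 < a) (hc : 0 < c) :
    ∫⁻ t in Ioc 0 c, ENNReal.ofReal (t ^ a) = ENNReal.ofReal (c ^ (a + 1) * (a + 1)⁻¹) := by
  have hint : IntegrableOn (fun t : ℝ => t ^ a) (Ioc 0 c) :=
    (intervalIntegrable_iff_integrableOn_Ioc_of_le hc.le).1
      (intervalIntegral.intervalIntegrable_rpow' ha)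
  rw [← ofReal_integral_eq_lintegral_ofReal hint, ← intervalIntegral.integral_of_le hc.le,
    integral_rpow (Or.inl ha), zero_rpow (by linarith), sub_zero, div_eq_mul_inv]
  filter_upwards [ae_restrict_mem measurableSet_Ioc] with t ht
  exact rpow_nonneg ht.1.le _

/-- Scaling bound for a Beta-type integral over the half-line. -/
lemma lintegral_Ioi_rpow_mul_add_rpow_le {r c l : ℝ} (hr : 0 < r) (hc : r < c) (hl : 0 < l) :
    ∫⁻ u in Ioi 0, ENNReal.ofReal ((l + u) ^ (-c)) * ENNReal.ofReal (u ^ (r - 1))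
      ≤ ENNReal.ofReal ((r⁻¹ + (c - r)⁻¹) * l ^ (r - c)) := by
  have hcr : 0 < c - r := sub_pos.2 hc
  rw [← Ioc_union_Ioi_eq_Ioi hl.le]
  refine (lintegral_union_le _ _ _).trans ?_
  have h₁ : ∫⁻ u in Ioc 0 l, ENNReal.ofReal ((l + u) ^ (-c)) * ENNReal.ofReal (u ^ (r - 1))
      ≤ ENNReal.ofReal (r⁻¹ * l ^ (r - c)) := by
    calc _ ≤ ∫⁻ u in Ioc 0 l, ENNReal.ofReal (l ^ (-c)) * ENNReal.ofReal (u ^ (r - 1)) := by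
          refine setLIntegral_mono' measurableSet_Ioc fun u hu => ?_
          gcongr ENNReal.ofReal ?_ * _
          exact rpow_le_rpow_of_nonpos hl (by linarith [hu.1]) (by linarith)
      _ = ENNReal.ofReal (r⁻¹ * l ^ (r - c)) := by
          rw [lintegral_const_mul' _ _ ENNReal.ofReal_ne_top,
            lintegral_Ioc_rpow (by linarith) hl, ← ENNReal.ofReal_mul (by positivity),
            sub_add_cancel, sub_eq_add_neg r c, rpow_add hl]
          congr 1
          ring
  have h₂ : ∫⁻ u in Ioi l, ENNReal.ofReal ((l + u) ^ (-c)) * ENNReal.ofReal (u ^ (r - 1))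
      ≤ ENNReal.ofReal ((c - r)⁻¹ * l ^ (r - c)) := by
    calc _ ≤ ∫⁻ u in Ioi l, ENNReal.ofReal (u ^ (r - c - 1)) := by
          refine setLIntegral_mono' measurableSet_Ioi fun u hu => ?_
          have hu : l < u := hu
          have hu₀ : 0 < u := hl.trans hu
          rw [← ENNReal.ofReal_mul (by positivity),
            show r - c - 1 = -c + (r - 1) by ring, rpow_add hu₀]
          gcongr ENNReal.ofReal (?_ * _)
          exact rpow_le_rpow_of_nonpos hu₀ (by linarith) (by linarith)
      _ = ENNReal.ofReal ((c - r)⁻¹ * l ^ (r - c)) := by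
          rw [lintegral_Ioi_rpow_of_lt (by linarith) hl, sub_add_cancel, neg_sub, mul_comm]
  calc _ ≤ _ := add_le_add h₁ h₂
    _ = _ := by
      rw [← ENNReal.ofReal_add (by positivity) (by positivity), add_mul]

/-- Weighted layer-cake formula for powers. -/
lemma lintegral_mul_rpow_eq_lintegral_superlevel {α : Type*} [MeasurableSpace α] (μ : Measure α)
    {Φ : α → ℝ≥0∞} (hΦ : Measurable Φ) {g : α → ℝ} (hg : Measurable g) (hg₀ : ∀ x, 0 ≤ g x)
    {r : ℝ} (hr : 0 < r) :
    ∫⁻ x, Φ x * ENNReal.ofReal (g x ^ r) ∂μ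
      = ENNReal.ofReal r *
        ∫⁻ t in Ioi 0, (∫⁻ x in {x | t < g x}, Φ x ∂μ) * ENNReal.ofReal (t ^ (r - 1)) := by
  have h := lintegral_rpow_eq_lintegral_meas_lt_mul (μ.withDensity Φ)
    (Filter.Eventually.of_forall hg₀) hg.aemeasurable hr
  rw [lintegral_withDensity_eq_lintegral_mul μ hΦ (hg.pow_const r).ennreal_ofReal] at h
  refine h.trans ?_
  congr 1
  refine lintegral_congr fun t => ?_
  rw [withDensity_apply _ (measurableSet_lt measurable_const hg)]

lemma one_add_div_pos_of_neg_lt {d γ : ℝ} (hd : 0 < d) (hγ : -d < γ) : 0 < 1 + γ / d := by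
  rw [← sub_neg_eq_add, sub_pos, ← neg_div, div_lt_one hd]
  linarith

/-- The Riesz potential of a set is bounded by a power of its volume. -/
lemma exists_setLIntegral_norm_sub_rpow_le (d : ℕ) (hd : 1 ≤ d) {γ : ℝ} (hγ₁ : -(d : ℝ) < γ)
    (hγ₂ : γ < 0) :
    ∃ C : ℝ≥0, ∀ (v : V d) (B : Set (V d)),
      ∫⁻ w in B, ENNReal.ofReal (‖v - w‖ ^ γ) ≤ C * volume B ^ (1 + γ / d) := by
  have hd₀ : (0 : ℝ) < d := by exact_mod_cast hd
  have hexp := one_add_div_pos_of_neg_lt hd₀ hγ₁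
  have hdγ : (d : ℝ) / γ < -1 := by
    rw [div_lt_iff_of_neg hγ₂]
    linarith
  have hK : 0 ≤ (-((d : ℝ) / γ + 1))⁻¹ := inv_nonneg.2 (by linarith)
  set ω : ℝ≥0∞ := volume (Metric.ball (0 : V d) 1) with hω
  have hωtop : ω ≠ ∞ := measure_ball_lt_top.ne
  set C : ℝ≥0∞ := 1 + ENNReal.ofReal (-((d : ℝ) / γ + 1))⁻¹ * ω with hC
  have hCtop : C ≠ ∞ :=
    ENNReal.add_ne_top.2 ⟨ENNReal.one_ne_top, ENNReal.mul_ne_top ENNReal.ofReal_ne_top hωtop⟩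
  refine ⟨C.toNNReal, fun v B => ?_⟩
  rw [ENNReal.coe_toNNReal hCtop]
  rcases eq_or_ne (volume B) 0 with h0 | h0
  · rw [setLIntegral_measure_zero _ _ h0]
    exact zero_le
  rcases eq_or_ne (volume B) ∞ with htop | htop
  · have : C ≠ 0 := by simp [hC]
    rw [htop, ENNReal.top_rpow_of_pos hexp, ENNReal.mul_top this]
    exact le_top
  obtain ⟨M, hM⟩ : ∃ M : ℝ, M = (volume B).toReal := ⟨_, rfl⟩
  have hM₀ : 0 < M := hM ▸ ENNReal.toReal_pos h0 htop
  have hB : volume B = ENNReal.ofReal M := by rw [hM, ENNReal.ofReal_toReal htop]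
  have hT : 0 < M ^ (γ / d) := rpow_pos_of_pos hM₀ _
  rw [lintegral_eq_lintegral_meas_lt _
    (Filter.Eventually.of_forall fun w => rpow_nonneg (norm_nonneg _) _) (by fun_prop),
    ← Ioc_union_Ioi_eq_Ioi hT.le]
  refine (lintegral_union_le _ _ _).trans ?_
  have h₁ : ∫⁻ t in Ioc 0 (M ^ (γ / d)), volume.restrict B {w | t < ‖v - w‖ ^ γ}
      ≤ ENNReal.ofReal (M ^ (1 + γ / d)) := by
    calc _ ≤ ∫⁻ _ in Ioc 0 (M ^ (γ / d)), volume B :=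
          lintegral_mono fun t => (measure_mono (subset_univ _)).trans_eq (by simp)
      _ = ENNReal.ofReal (M ^ (1 + γ / d)) := by
          rw [setLIntegral_const, Real.volume_Ioc, sub_zero, hB, ← ENNReal.ofReal_mul hM₀.le,
            rpow_add hM₀, rpow_one]
  have h₂ : ∫⁻ t in Ioi (M ^ (γ / d)), volume.restrict B {w | t < ‖v - w‖ ^ γ}
      ≤ ENNReal.ofReal (M ^ (1 + γ / d)) * (ENNReal.ofReal (-((d : ℝ) / γ + 1))⁻¹ * ω) := by
    calc _ ≤ ∫⁻ t in Ioi (M ^ (γ / d)), ENNReal.ofReal (t ^ ((d : ℝ) / γ)) * ω := by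
          refine setLIntegral_mono' measurableSet_Ioi fun t ht => ?_
          have ht₀ : 0 < t := hT.trans ht
          have hsub : {w : V d | t < ‖v - w‖ ^ γ} ⊆ Metric.ball v (t ^ γ⁻¹) := by
            intro w hw
            rw [mem_ball_iff_norm']
            rcases (norm_nonneg (v - w)).eq_or_lt with h | h
            · rw [← h]
              exact rpow_pos_of_pos ht₀ _
            · exact (lt_rpow_inv_iff_of_neg h ht₀ hγ₂).2 hw
          refine (Measure.restrict_apply_le _ _).trans ((measure_mono hsub).trans_eq ?_)
          rw [Measure.addHaar_ball_of_pos _ _ (rpow_pos_of_pos ht₀ _), finrank_euclideanSpace_fin,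
            ← rpow_mul_natCast ht₀.le, div_eq_inv_mul]
      _ = _ := by
          rw [lintegral_mul_const' _ _ hωtop, lintegral_Ioi_rpow_of_lt hdγ hT,
            ← rpow_mul hM₀.le, ENNReal.ofReal_mul (by positivity), mul_assoc]
          congr 4
          field_simp [hγ₂.ne]
  calc _ ≤ _ := add_le_add h₁ h₂
    _ = _ := by
      rw [hB, ENNReal.ofReal_rpow_of_pos hM₀, hC]
      ring

/-- Riesz rearrangement-type bound for the interaction energy of two sets, with the powers of the
two volumes distributed arbitrarily. -/
lemma exists_setLIntegral_setLIntegral_norm_sub_rpow_le (d : ℕ) (hd : 1 ≤ d) {γ : ℝ}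
    (hγ₁ : -(d : ℝ) < γ) (hγ₂ : γ < 0) :
    ∃ C : ℝ≥0, ∀ (a b : ℝ), 0 ≤ a → 0 ≤ b → a ≤ 1 → b ≤ 1 → a + b = 2 + γ / d →
      ∀ A B : Set (V d),
      ∫⁻ w in B, ∫⁻ v in A, ENNReal.ofReal (‖v - w‖ ^ γ)
        ≤ C * (volume B ^ a * volume A ^ b) := by
  obtain ⟨C, hC⟩ := exists_setLIntegral_norm_sub_rpow_le d hd hγ₁ hγ₂
  have hexp := one_add_div_pos_of_neg_lt (by exact_mod_cast hd : (0 : ℝ) < d) hγ₁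
  refine ⟨C, fun a b ha hb ha₁ hb₁ hab A B => ?_⟩
  have hrpow : ∀ {x y : ℝ} (z : ℝ), 0 ≤ x → 0 ≤ y → z = x + y → ∀ m : ℝ≥0∞,
      m ^ z = m ^ x * m ^ y := fun z hx hy h m => by rw [h, ENNReal.rpow_add_of_nonneg _ _ hx hy]
  rcases le_total (volume B) (volume A) with h | h
  · calc _ ≤ ∫⁻ w in B, C * volume A ^ (1 + γ / d) := by
          refine lintegral_mono fun w => ?_
          simpa only [norm_sub_rev] using hC w A
      _ = C * (volume B ^ (a + (1 - a)) * volume A ^ (1 + γ / d)) := by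
          rw [setLIntegral_const, add_sub_cancel, ENNReal.rpow_one]
          ring
      _ ≤ C * (volume B ^ a * volume A ^ (1 - a) * volume A ^ (1 + γ / d)) := by
          rw [ENNReal.rpow_add_of_nonneg _ _ ha (by linarith)]
          gcongr
      _ = _ := by
          rw [hrpow b (x := 1 - a) (y := 1 + γ / d) (by linarith) hexp.le (by linarith)]
          ring
  · calc _ ≤ ∫⁻ v in A, ∫⁻ w in B, ENNReal.ofReal (‖v - w‖ ^ γ) := by
          rw [lintegral_lintegral_swap]
          fun_prop
      _ ≤ ∫⁻ v in A, C * volume B ^ (1 + γ / d) := lintegral_mono fun v => hC v B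
      _ = C * (volume A ^ (b + (1 - b)) * volume B ^ (1 + γ / d)) := by
          rw [setLIntegral_const, add_sub_cancel, ENNReal.rpow_one]
          ring
      _ ≤ C * (volume A ^ b * volume B ^ (1 - b) * volume B ^ (1 + γ / d)) := by
          rw [ENNReal.rpow_add_of_nonneg _ _ hb (by linarith)]
          gcongr
      _ = _ := by
          rw [hrpow a (x := 1 - b) (y := 1 + γ / d) (by linarith) hexp.le (by linarith)]
          ring

/-- A Hardy–Littlewood–Sobolev estimate for functions with a shifted weak-type decay of their
superlevel sets. -/
lemma exists_lintegral_lintegral_norm_sub_rpow_le (d : ℕ) (hd : 1 ≤ d) {γ : ℝ}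
    (hγ₁ : -(d : ℝ) < γ) (hγ₂ : γ < 0) {r q : ℝ} (hr : 0 < r) (hrq : r < q) (hq : 1 < q)
    (hrq' : r + 1 < q * (2 + γ / d)) :
    ∃ C : ℝ, 0 ≤ C ∧ ∀ g : V d → ℝ, Measurable g → (∀ v, 0 ≤ g v) → ∀ l : ℝ, 0 < l →
      ∀ N : ℝ≥0∞, (∀ t, 0 < t → volume {v | t < g v} ≤ N * ENNReal.ofReal ((l + t) ^ (-q))) →
      ∫⁻ v, ∫⁻ w, ENNReal.ofReal (‖v - w‖ ^ γ * g w * g v ^ r)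
        ≤ ENNReal.ofReal (C * l ^ (r + 1 - q * (2 + γ / d))) * N ^ (2 + γ / d) := by
  have hd₀ : (0 : ℝ) < d := by exact_mod_cast hd
  have hq₀ : 0 < q := one_pos.trans hq
  have hγd : γ / d < 0 := div_neg_of_neg_of_pos hγ₂ hd₀
  obtain ⟨C₀, hC₀⟩ := exists_setLIntegral_setLIntegral_norm_sub_rpow_le d hd hγ₁ hγ₂
  obtain ⟨a, ha, ha'⟩ : ∃ a, max (1 / q) (1 + γ / d) < a ∧ a < min 1 (2 + γ / d - r / q) := by
    have h₁ : 1 / q < 1 := (div_lt_one hq₀).2 hq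
    have h₂ : r / q < 1 := (div_lt_one hq₀).2 hrq
    have h₃ : (r + 1) / q < 2 + γ / d := (div_lt_iff₀' hq₀).2 hrq'
    rw [add_div] at h₃
    exact exists_between (max_lt (lt_min h₁ (by linarith)) (lt_min (by linarith) (by linarith)))
  rw [max_lt_iff] at ha
  rw [lt_min_iff] at ha'
  obtain ⟨b, hab⟩ : ∃ b, a + b = 2 + γ / d := ⟨2 + γ / d - a, by ring⟩
  have ha₀ : 0 < a := (by positivity : 0 < 1 / q).trans ha.1
  have hrb : r / q < b := by linarith [ha'.2]
  have hb₀ : 0 < b := (by positivity : 0 < r / q).trans hrb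
  have hqa : 1 < q * a := (div_lt_iff₀' hq₀).1 ha.1
  have hqb : r < q * b := (div_lt_iff₀' hq₀).1 hrb
  set K₁ : ℝ := 1⁻¹ + (q * a - 1)⁻¹
  set K₂ : ℝ := r⁻¹ + (q * b - r)⁻¹
  have hK₁ : 0 ≤ K₁ := add_nonneg (by norm_num) (inv_nonneg.2 (by linarith))
  have hK₂ : 0 ≤ K₂ := add_nonneg (by positivity) (inv_nonneg.2 (by linarith))
  refine ⟨r * C₀ * K₁ * K₂, by positivity, fun g hg hg₀ l hl N hN => ?_⟩
  have hpow : ∀ {e : ℝ}, 0 ≤ e → ∀ t : ℝ, 0 < t →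
      volume {v | t < g v} ^ e ≤ N ^ e * ENNReal.ofReal ((l + t) ^ (-(q * e))) := by
    intro e he t ht
    refine (ENNReal.rpow_le_rpow (hN t ht) he).trans_eq ?_
    rw [ENNReal.mul_rpow_of_nonneg _ _ he, ENNReal.ofReal_rpow_of_pos (by positivity),
      ← rpow_mul (by positivity), neg_mul]
  set Φ : V d → ℝ≥0∞ := fun v => ∫⁻ w, ENNReal.ofReal (‖v - w‖ ^ γ) * ENNReal.ofReal (g w)
  have hΦ : Measurable Φ := by
    refine Measurable.lintegral_prod_right' (f := fun z : V d × V d =>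
      ENNReal.ofReal (‖z.1 - z.2‖ ^ γ) * ENNReal.ofReal (g z.2)) ?_
    fun_prop
  have hinner : ∀ u, 0 < u → ∫⁻ v in {v | u < g v}, Φ v
      ≤ C₀ * N ^ a * ENNReal.ofReal (K₁ * l ^ (1 - q * a)) * volume {v | u < g v} ^ b := by
    intro u _
    set A : Set (V d) := {v | u < g v}
    have hΨ : Measurable fun w : V d => ∫⁻ v in A, ENNReal.ofReal (‖v - w‖ ^ γ) := by
      refine Measurable.lintegral_prod_left' (f := fun z : V d × V d =>
        ENNReal.ofReal (‖z.1 - z.2‖ ^ γ)) ?_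
      fun_prop
    calc ∫⁻ v in A, Φ v
        = ∫⁻ w, (∫⁻ v in A, ENNReal.ofReal (‖v - w‖ ^ γ)) * ENNReal.ofReal (g w ^ (1 : ℝ)) := by
          rw [lintegral_lintegral_swap (by fun_prop)]
          refine lintegral_congr fun w => ?_
          rw [lintegral_mul_const' _ _ ENNReal.ofReal_ne_top, rpow_one]
      _ = ∫⁻ t in Ioi 0, (∫⁻ w in {w | t < g w}, ∫⁻ v in A, ENNReal.ofReal (‖v - w‖ ^ γ))
            * ENNReal.ofReal (t ^ ((1 : ℝ) - 1)) := by
          rw [lintegral_mul_rpow_eq_lintegral_superlevel _ hΨ hg hg₀ one_pos, ENNReal.ofReal_one,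
            one_mul]
      _ ≤ ∫⁻ t in Ioi 0, C₀ * N ^ a * volume A ^ b *
            (ENNReal.ofReal ((l + t) ^ (-(q * a))) * ENNReal.ofReal (t ^ ((1 : ℝ) - 1))) := by
          refine setLIntegral_mono' measurableSet_Ioi fun t ht => ?_
          rw [← mul_assoc]
          gcongr
          refine (hC₀ a b ha₀.le hb₀.le ha'.1.le (by linarith [ha.2]) hab A _).trans ?_
          calc _ ≤ C₀ * (N ^ a * ENNReal.ofReal ((l + t) ^ (-(q * a))) * volume A ^ b) := by
                gcongr
                exact hpow ha₀.le t ht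
            _ = _ := by ring
      _ ≤ C₀ * N ^ a * volume A ^ b * ENNReal.ofReal (K₁ * l ^ (1 - q * a)) := by
          rw [lintegral_const_mul _ (by fun_prop)]
          gcongr
          exact lintegral_Ioi_rpow_mul_add_rpow_le one_pos hqa hl
      _ = _ := by ring
  calc ∫⁻ v, ∫⁻ w, ENNReal.ofReal (‖v - w‖ ^ γ * g w * g v ^ r)
      = ∫⁻ v, Φ v * ENNReal.ofReal (g v ^ r) := by
        refine lintegral_congr fun v => ?_
        rw [← lintegral_mul_const' _ _ ENNReal.ofReal_ne_top]
        refine lintegral_congr fun w => ?_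
        have := hg₀ w
        rw [ENNReal.ofReal_mul (by positivity), ENNReal.ofReal_mul (by positivity)]
    _ = ENNReal.ofReal r *
          ∫⁻ u in Ioi 0, (∫⁻ v in {v | u < g v}, Φ v) * ENNReal.ofReal (u ^ (r - 1)) :=
        lintegral_mul_rpow_eq_lintegral_superlevel _ hΦ hg hg₀ hr
    _ ≤ ENNReal.ofReal r * ∫⁻ u in Ioi 0,
          C₀ * N ^ a * ENNReal.ofReal (K₁ * l ^ (1 - q * a)) * N ^ b *
            (ENNReal.ofReal ((l + u) ^ (-(q * b))) * ENNReal.ofReal (u ^ (r - 1))) := by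
        gcongr ENNReal.ofReal r * ?_
        refine setLIntegral_mono' measurableSet_Ioi fun u hu => ?_
        rw [← mul_assoc]
        gcongr
        refine (hinner u hu).trans ?_
        rw [mul_assoc _ (N ^ b)]
        gcongr
        exact hpow hb₀.le u hu
    _ ≤ ENNReal.ofReal r * (C₀ * N ^ a * ENNReal.ofReal (K₁ * l ^ (1 - q * a)) * N ^ b *
          ENNReal.ofReal (K₂ * l ^ (r - q * b))) := by
        rw [lintegral_const_mul _ (by fun_prop)]
        gcongr
        exact lintegral_Ioi_rpow_mul_add_rpow_le hr hqb hl
    _ = _ := by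
        rw [← hab, ENNReal.rpow_add_of_nonneg _ _ ha₀.le hb₀.le,
          show r + 1 - q * (a + b) = (1 - q * a) + (r - q * b) by ring, rpow_add hl,
          show r * C₀ * K₁ * K₂ * (l ^ (1 - q * a) * l ^ (r - q * b))
            = r * C₀ * (K₁ * l ^ (1 - q * a)) * (K₂ * l ^ (r - q * b)) by ring,
          ENNReal.ofReal_mul (p := r * C₀ * (K₁ * l ^ (1 - q * a))) (by positivity),
          ENNReal.ofReal_mul (p := r * C₀) (by positivity), ENNReal.ofReal_mul hr.le, ENNReal.ofReal_coe_nnreal]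
        ring

lemma slvl_nonneg {d : ℕ} (f : V d → ℝ) (l : ℝ) (v : V d) : 0 ≤ slvl f l v := le_max_right _ _

lemma measurable_slvl {d : ℕ} {f : V d → ℝ} (hf : Measurable f) (l : ℝ) :
    Measurable (slvl f l) := (hf.sub_const l).max measurable_const

/-- Chebyshev's inequality for the superlevel sets of `f_ℓ⁺` in terms of `f_k⁺`. -/
lemma volume_lt_slvl_le {d : ℕ} {f : V d → ℝ} (hf : Measurable f) {k l q t : ℝ} (hkl : k < l)
    (hq : 0 ≤ q) (ht : 0 < t) :
    volume {v | t < slvl f l v}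
      ≤ (∫⁻ v, ENNReal.ofReal (slvl f k v ^ q)) * ENNReal.ofReal ((l - k + t) ^ (-q)) := by
  have hpos : 0 < l - k + t := by linarith
  have hsub : {v | t < slvl f l v}
      ⊆ {v | ENNReal.ofReal ((l - k + t) ^ q) ≤ ENNReal.ofReal (slvl f k v ^ q)} := by
    intro v hv
    have hv : t < f v - l := (lt_max_iff.1 (mem_ofPred.1 hv)).resolve_right ht.not_gt
    have hle : l - k + t ≤ slvl f k v := le_max_of_le_left (by linarith)
    exact ENNReal.ofReal_le_ofReal (rpow_le_rpow hpos.le hle hq)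
  have hcheb := mul_meas_ge_le_lintegral (μ := volume)
    ((measurable_slvl hf k).pow_const q).ennreal_ofReal (ENNReal.ofReal ((l - k + t) ^ q))
  have hne : ENNReal.ofReal ((l - k + t) ^ q) ≠ 0 :=
    (ENNReal.ofReal_pos.2 (rpow_pos_of_pos hpos _)).ne'
  rw [rpow_neg hpos.le, ENNReal.ofReal_inv_of_pos (rpow_pos_of_pos hpos _), ← div_eq_mul_inv,
    ENNReal.le_div_iff_mul_le (Or.inl hne) (Or.inl ENNReal.ofReal_ne_top), mul_comm]
  exact (mul_le_mul_right (measure_mono hsub) _).trans hcheb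

/-- Lemma 2.5, estimates (2.6)–(2.7): for `d ≥ 1`, `γ ∈ (−d,0)`,
`p ∈ (1, d/(d+γ))` and `q > (p+1)d/(2d+γ)` there is `C > 0` depending only on
`p, q, γ, d` such that for every nonnegative measurable `f` and all `0 ≤ k < ℓ`:
`−∫ c_γ[f_ℓ⁺](f_ℓ⁺)^p ≤ C (ℓ−k)^{p+1−q(2d+γ)/d} ‖f_k⁺‖_q^{q(2d+γ)/d}` and
`−∫ c_γ[f_ℓ⁺](f_ℓ⁺)^{p−1} ≤ C (ℓ−k)^{p−q(2d+γ)/d} ‖f_k⁺‖_q^{q(2d+γ)/d}`. -/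
theorem level_set_HLS_estimates
    (d : ℕ) (hd : 1 ≤ d) (γ : ℝ) (hγ₁ : -(d : ℝ) < γ) (hγ₂ : γ < 0)
    (p : ℝ) (hp₁ : 1 < p) (hp₂ : p < (d : ℝ) / (d + γ))
    (q : ℝ) (hq : (p + 1) * (d : ℝ) / (2 * d + γ) < q) :
    ∃ C : ℝ, 0 < C ∧
      ∀ f : V d → ℝ, Measurable f → (∀ v, 0 ≤ f v) →
      ∀ k ℓ : ℝ, 0 ≤ k → k < ℓ →
        ((∫⁻ v : V d, ∫⁻ w : V d,
            ENNReal.ofReal (((d : ℝ) - 1) * (γ + d) * ‖v - w‖ ^ γ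
              * slvl f ℓ w * slvl f ℓ v ^ p))
          ≤ ENNReal.ofReal (C * (ℓ - k) ^ (p + 1 - q * (2 * (d : ℝ) + γ) / d))
            * (∫⁻ v : V d, ENNReal.ofReal (slvl f k v ^ q)) ^ ((2 * (d : ℝ) + γ) / d)) ∧
        ((∫⁻ v : V d, ∫⁻ w : V d,
            ENNReal.ofReal (((d : ℝ) - 1) * (γ + d) * ‖v - w‖ ^ γ
              * slvl f ℓ w * slvl f ℓ v ^ (p - 1)))
          ≤ ENNReal.ofReal (C * (ℓ - k) ^ (p - q * (2 * (d : ℝ) + γ) / d))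
            * (∫⁻ v : V d, ENNReal.ofReal (slvl f k v ^ q)) ^ ((2 * (d : ℝ) + γ) / d)) := by
  have hd₀ : (0 : ℝ) < d := by exact_mod_cast hd
  have hd₁ : (0 : ℝ) ≤ d - 1 := sub_nonneg.2 (by exact_mod_cast hd)
  have hc : 0 ≤ ((d : ℝ) - 1) * (γ + d) := mul_nonneg hd₁ (by linarith)
  have hs : (2 * (d : ℝ) + γ) / d = 2 + γ / d := by field_simp
  have hpq : p < q := by
    refine lt_trans ?_ hq
    rw [lt_div_iff₀ (by linarith)]
    rw [lt_div_iff₀ (by linarith)] at hp₂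
    linarith
  have hsq : p + 1 < q * (2 + γ / d) := by
    rw [← hs, ← mul_div_assoc, lt_div_iff₀ hd₀]
    rwa [div_lt_iff₀ (by linarith)] at hq
  obtain ⟨C₁, hC₁, h₁⟩ := exists_lintegral_lintegral_norm_sub_rpow_le d hd hγ₁ hγ₂ (r := p)
    (q := q) (by linarith) hpq (by linarith) hsq
  obtain ⟨C₂, hC₂, h₂⟩ := exists_lintegral_lintegral_norm_sub_rpow_le d hd hγ₁ hγ₂ (r := p - 1)
    (q := q) (by linarith) (by linarith) (by linarith) (by linarith)
  have hconst : ∀ (g : V d → ℝ) (r C x : ℝ) (X : ℝ≥0∞), 0 ≤ x →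
      ((d : ℝ) - 1) * (γ + d) * C ≤ ((d : ℝ) - 1) * (γ + d) * (C₁ + C₂) + 1 →
      ∫⁻ v, ∫⁻ w, ENNReal.ofReal (‖v - w‖ ^ γ * g w * g v ^ r) ≤ ENNReal.ofReal (C * x) * X →
      ∫⁻ v, ∫⁻ w, ENNReal.ofReal (((d : ℝ) - 1) * (γ + d) * ‖v - w‖ ^ γ * g w * g v ^ r)
        ≤ ENNReal.ofReal ((((d : ℝ) - 1) * (γ + d) * (C₁ + C₂) + 1) * x) * X := by
    intro g r C x X hx hC h
    calc _ = ENNReal.ofReal (((d : ℝ) - 1) * (γ + d)) *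
          ∫⁻ v, ∫⁻ w, ENNReal.ofReal (‖v - w‖ ^ γ * g w * g v ^ r) := by
          rw [← lintegral_const_mul' _ _ ENNReal.ofReal_ne_top]
          refine lintegral_congr fun v => ?_
          rw [← lintegral_const_mul' _ _ ENNReal.ofReal_ne_top]
          refine lintegral_congr fun w => ?_
          rw [← ENNReal.ofReal_mul hc, ← mul_assoc, ← mul_assoc]
      _ ≤ ENNReal.ofReal (((d : ℝ) - 1) * (γ + d)) * (ENNReal.ofReal (C * x) * X) := by gcongr
      _ = ENNReal.ofReal (((d : ℝ) - 1) * (γ + d) * C * x) * X := by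
          rw [← mul_assoc, ← ENNReal.ofReal_mul hc, ← mul_assoc]
      _ ≤ _ := by gcongr
  refine ⟨((d : ℝ) - 1) * (γ + d) * (C₁ + C₂) + 1, by positivity, ?_⟩
  intro f hf _ k ℓ _ hkl
  have hlk : 0 < ℓ - k := sub_pos.2 hkl
  have hN := fun t (ht : 0 < t) => volume_lt_slvl_le hf hkl (q := q) (by linarith) ht
  rw [mul_div_assoc, hs]
  constructor
  · refine hconst _ _ C₁ _ _ (by positivity) (by nlinarith) ?_
    exact h₁ _ (measurable_slvl hf ℓ) (slvl_nonneg f ℓ) _ hlk _ hN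
  · refine hconst _ _ C₂ _ _ (by positivity) (by nlinarith) ?_
    simpa only [sub_add_cancel] using
      h₂ _ (measurable_slvl hf ℓ) (slvl_nonneg f ℓ) _ hlk _ hN
end
end

section
/- Let d ≥ 3, γ ∈ (−d, 0), p > 1 and k ≥ 0. Then with C_{d,γ} = 3(γ+d+2)/(γ+d) and c_{d,γ} = 3(d−1)(γ+d+2)·∫f⟨v⟩²dv, the following holds for every nonnegative measurable function f on ℝ^d with finite ∫f⟨v⟩²dv (and all quantities below finite): −Σ_{i=0}^{2} ∫_{ℝ^d} ⟨v⟩^{k−i} c_{γ+i}[f](v) f(v)^p dv ≤ −C_{d,γ} ∫_{ℝ^d} ⟨v⟩^k c̄_γ[f](v) f(v)^p dv + c_{d,γ} ∫_{ℝ^d} ⟨v⟩^k f(v)^p dv, where c̄_γ[f](v) = −(d−1)(d+γ)∫_{|v−w|≤1}|v−w|^γ f(w) dw. -/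
open MeasureTheory Real Set Function
open scoped ENNReal NNReal RealInnerProductSpace

noncomputable section

lemma one_le_jb {d : ℕ} (v : V d) : 1 ≤ jb v := by
  rw [jb, Real.one_le_sqrt]
  nlinarith [sq_nonneg ‖v‖]

lemma norm_sub_le_jb_mul_jb {d : ℕ} (v w : V d) : ‖v - w‖ ≤ jb v * jb w := by
  rw [jb, jb, ← Real.sqrt_mul (by positivity)]
  apply Real.le_sqrt_of_sq_le
  have h := norm_sub_le v w
  nlinarith [norm_nonneg (v - w), norm_nonneg v, norm_nonneg w, sq_nonneg (‖v‖ * ‖w‖ - 1)]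

/-- The truncated Riesz kernel is integrable. -/
lemma integrable_indicator_norm_rpow {d : ℕ} (hd : 0 < d) {γ : ℝ} (hγ : -(d : ℝ) < γ) :
    Integrable ({z : V d | ‖z‖ ≤ 1}.indicator (fun z => ‖z‖ ^ γ)) := by
  have : Nonempty (Fin d) := ⟨⟨0, hd⟩⟩
  have hms : MeasurableSet {z : V d | ‖z‖ ≤ 1} := measurableSet_le measurable_norm measurable_const
  rw [integrable_indicator_iff hms]
  have hball : IntegrableOn (fun z : V d => ‖z‖ ^ γ) (Metric.ball 0 2) := by
    rw [integrableOn_fun_norm_addHaar volume (f := fun r : ℝ => r ^ γ)]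
    have hpow : IntegrableOn (fun y : ℝ => y ^ ((d : ℝ) - 1 + γ)) (Ioo 0 2) :=
      (intervalIntegral.integrableOn_Ioo_rpow_iff two_pos).2 (by linarith)
    refine hpow.congr_fun (fun y hy => ?_) measurableSet_Ioo
    have hcast : ((d - 1 : ℕ) : ℝ) = (d : ℝ) - 1 := by
      rw [Nat.cast_sub hd, Nat.cast_one]
    simp only [finrank_euclideanSpace, Fintype.card_fin, smul_eq_mul]
    rw [← Real.rpow_natCast, hcast, Real.rpow_add hy.1]
  refine hball.mono_set fun z hz => ?_
  simp only [mem_ofPred_eq] at hz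
  simp only [Metric.mem_ball, dist_zero_right]
  linarith

/-- The truncated convolution of an integrable function with `|·|^γ` converges almost
everywhere. -/
lemma ae_integrableOn_norm_sub_rpow_mul {d : ℕ} (hd : 0 < d) {γ : ℝ} (hγ : -(d : ℝ) < γ)
    {f : V d → ℝ} (hf : Integrable f) :
    ∀ᵐ v : V d, IntegrableOn (fun w => ‖v - w‖ ^ γ * f w) {w : V d | ‖v - w‖ ≤ 1} := by
  have h := hf.ae_convolution_exists (ContinuousLinearMap.mul ℝ ℝ)
    (integrable_indicator_norm_rpow hd hγ)
  filter_upwards [h] with v hv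
  have hms : MeasurableSet {w : V d | ‖v - w‖ ≤ 1} :=
    measurableSet_le (by fun_prop) measurable_const
  rw [← integrable_indicator_iff hms]
  refine hv.congr (Filter.Eventually.of_forall fun w => ?_)
  by_cases hw : ‖v - w‖ ≤ 1
  · simp [hw, mul_comm]
  · simp [hw]

/-- Splitting `|v-w|^{γ+i}` at `|v-w| = 1`. -/
lemma norm_rpow_add_le {d : ℕ} {γ : ℝ} (hγ : γ < 0) {i : ℕ} (hi : i ≤ 2) {v w : V d}
    (hvw : w ≠ v) :
    ‖v - w‖ ^ (γ + (i : ℝ)) ≤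
      {w : V d | ‖v - w‖ ≤ 1}.indicator (fun w => ‖v - w‖ ^ γ) w
        + jb v ^ (i : ℝ) * jb w ^ (2 : ℝ) := by
  have hpos : 0 < ‖v - w‖ := norm_pos_iff.2 (sub_ne_zero.2 hvw.symm)
  have hi' : (i : ℝ) ≤ 2 := by exact_mod_cast hi
  have hv := one_le_jb v
  have hw := one_le_jb w
  by_cases h : ‖v - w‖ ≤ 1
  · rw [indicator_of_mem (by exact h)]
    have h1 : ‖v - w‖ ^ (γ + (i : ℝ)) ≤ ‖v - w‖ ^ γ :=
      Real.rpow_le_rpow_of_exponent_ge hpos h (by linarith [Nat.cast_nonneg (α := ℝ) i])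
    have h2 : 0 ≤ jb v ^ (i : ℝ) * jb w ^ (2 : ℝ) := by positivity
    linarith
  · rw [indicator_of_notMem (by exact h), zero_add]
    calc ‖v - w‖ ^ (γ + (i : ℝ)) ≤ ‖v - w‖ ^ (i : ℝ) :=
          Real.rpow_le_rpow_of_exponent_le (not_le.1 h).le (by linarith)
      _ ≤ (jb v * jb w) ^ (i : ℝ) :=
          Real.rpow_le_rpow hpos.le (norm_sub_le_jb_mul_jb v w) (Nat.cast_nonneg i)
      _ = jb v ^ (i : ℝ) * jb w ^ (i : ℝ) := Real.mul_rpow (by linarith) (by linarith)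
      _ ≤ jb v ^ (i : ℝ) * jb w ^ (2 : ℝ) := by
          gcongr

lemma integral_norm_rpow_add_mul_le {d : ℕ} (hd : 0 < d) {γ : ℝ} (hγ : γ < 0) {i : ℕ}
    (hi : i ≤ 2) {f : V d → ℝ} (hnn : ∀ v, 0 ≤ f v)
    (hf : Integrable (fun v : V d => f v * jb v ^ (2 : ℝ))) {v : V d}
    (hv : IntegrableOn (fun w => ‖v - w‖ ^ γ * f w) {w : V d | ‖v - w‖ ≤ 1}) :
    ∫ w : V d, ‖v - w‖ ^ (γ + (i : ℝ)) * f w ≤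
      (∫ w in {w : V d | ‖v - w‖ ≤ 1}, ‖v - w‖ ^ γ * f w)
        + jb v ^ (i : ℝ) * ∫ w : V d, f w * jb w ^ (2 : ℝ) := by
  have : Nonempty (Fin d) := ⟨⟨0, hd⟩⟩
  have hms : MeasurableSet {w : V d | ‖v - w‖ ≤ 1} :=
    measurableSet_le (by fun_prop) measurable_const
  rw [← integral_indicator hms, ← integral_const_mul,
    ← integral_add (hv.integrable_indicator hms) (hf.const_mul _)]
  refine integral_mono_of_nonneg
    (Filter.Eventually.of_forall fun w => mul_nonneg (by positivity) (hnn w))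
    ((hv.integrable_indicator hms).add (hf.const_mul _)) ?_
  filter_upwards [volume.ae_ne v] with w hw
  have h := mul_le_mul_of_nonneg_right (norm_rpow_add_le hγ hi hw) (hnn w)
  refine h.trans (le_of_eq ?_)
  rw [add_mul, indicator_mul_left]
  ring

/-- Pointwise comparison of the weighted coefficient with the truncated one. -/
lemma neg_weighted_cCoef_le {d : ℕ} (hd : 1 ≤ d) {γ : ℝ} (hγ₁ : -(d : ℝ) < γ) (hγ₂ : γ < 0)
    (k p : ℝ) {i : ℕ} (hi : i ≤ 2) {f : V d → ℝ} (hnn : ∀ v, 0 ≤ f v)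
    (hf : Integrable (fun v : V d => f v * jb v ^ (2 : ℝ))) {v : V d}
    (hv : IntegrableOn (fun w => ‖v - w‖ ^ γ * f w) {w : V d | ‖v - w‖ ≤ 1}) :
    -(jb v ^ (k - (i : ℝ)) * cCoef d (γ + (i : ℝ)) f v * f v ^ p) ≤
      -((γ + d + 2) / (γ + d)) * (jb v ^ k * cConvTrunc d γ f v * f v ^ p)
        + (((d : ℝ) - 1) * (γ + d + 2) * ∫ v : V d, f v * jb v ^ (2 : ℝ))
          * (jb v ^ k * f v ^ p) := by
  have hI := integral_norm_rpow_add_mul_le hd hγ₂ hi hnn hf hv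
  have hi' : (i : ℝ) ≤ 2 := by exact_mod_cast hi
  have hi0 : (0 : ℝ) ≤ i := Nat.cast_nonneg i
  have hd' : (1 : ℝ) ≤ d := by exact_mod_cast hd
  have hjb := one_le_jb v
  have hN : 0 ≤ ∫ w in {w : V d | ‖v - w‖ ≤ 1}, ‖v - w‖ ^ γ * f w :=
    integral_nonneg fun w => mul_nonneg (by positivity) (hnn w)
  have hE : 0 ≤ ∫ w : V d, f w * jb w ^ (2 : ℝ) :=
    integral_nonneg fun w => mul_nonneg (hnn w) (Real.rpow_nonneg (by linarith [one_le_jb w]) _)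
  have hne : γ + (i : ℝ) ≠ -(d : ℝ) := by linarith
  have hγd : γ + (d : ℝ) ≠ 0 := by linarith
  rw [cCoef, if_neg hne, cConv, cConvTrunc]
  set I := ∫ w : V d, ‖v - w‖ ^ (γ + (i : ℝ)) * f w
  set N := ∫ w in {w : V d | ‖v - w‖ ≤ 1}, ‖v - w‖ ^ γ * f w
  set M := ∫ w : V d, f w * jb w ^ (2 : ℝ)
  have hP : 0 ≤ f v ^ p := Real.rpow_nonneg (hnn v) p
  have hsplit : jb v ^ (k - (i : ℝ)) * jb v ^ (i : ℝ) = jb v ^ k := by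
    rw [← Real.rpow_add (by linarith), sub_add_cancel]
  have hle : jb v ^ (k - (i : ℝ)) ≤ jb v ^ k :=
    Real.rpow_le_rpow_of_exponent_le hjb (by linarith)
  have hJ : 0 ≤ jb v ^ (k - (i : ℝ)) := Real.rpow_nonneg (by linarith) _
  have hJk : 0 ≤ jb v ^ k := Real.rpow_nonneg (by linarith) _
  have hJI : jb v ^ (k - (i : ℝ)) * I ≤ jb v ^ k * (N + M) :=
    calc jb v ^ (k - (i : ℝ)) * I ≤ jb v ^ (k - (i : ℝ)) * (N + jb v ^ (i : ℝ) * M) := by gcongr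
      _ = jb v ^ (k - (i : ℝ)) * N + jb v ^ k * M := by rw [← hsplit]; ring
      _ ≤ jb v ^ k * N + jb v ^ k * M := by gcongr
      _ = jb v ^ k * (N + M) := by ring
  have hd0 : 0 ≤ (d : ℝ) - 1 := by linarith
  have hγi : 0 ≤ γ + i + d := by linarith
  calc _ = ((d : ℝ) - 1) * (γ + i + d) * (jb v ^ (k - (i : ℝ)) * I) * f v ^ p := by ring
    _ ≤ ((d : ℝ) - 1) * (γ + d + 2) * (jb v ^ k * (N + M)) * f v ^ p := by
        have hc : γ + i + d ≤ γ + d + 2 := by linarith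
        have h0 : 0 ≤ jb v ^ k * (N + M) := by positivity
        have h1 : ((d : ℝ) - 1) * (γ + i + d) ≤ ((d : ℝ) - 1) * (γ + d + 2) := by gcongr
        have h2 : 0 ≤ ((d : ℝ) - 1) * (γ + i + d) := by positivity
        gcongr ?_ * f v ^ p
        exact (mul_le_mul_of_nonneg_left hJI h2).trans (mul_le_mul_of_nonneg_right h1 h0)
    _ = _ := by
        field_simp

/-- Lemma 3.3, first part: for `d ≥ 3`, `γ ∈ (−d,0)`, `p > 1`,
`k ≥ 0`, with `C_{d,γ} = 3(γ+d+2)/(γ+d)` and `c_{d,γ} = 3(d−1)(γ+d+2)·∫f⟨v⟩²`, every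
nonnegative measurable `f` with finite energy (and all quantities finite) satisfies
`−Σ_{i=0}^{2} ∫ ⟨v⟩^{k−i} c_{γ+i}[f] f^p ≤ −C_{d,γ} ∫ ⟨v⟩^k c̄_γ[f] f^p + c_{d,γ} ∫ ⟨v⟩^k f^p`. -/
theorem coefficient_comparison
    (d : ℕ) (hd : 3 ≤ d) (γ : ℝ) (hγ₁ : -(d : ℝ) < γ) (hγ₂ : γ < 0)
    (p k : ℝ) (hp : 1 < p) (hk : 0 ≤ k)
    (f : V d → ℝ) (hmeas : Measurable f) (hnn : ∀ v, 0 ≤ f v)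
    (hL12 : Integrable (fun v : V d => f v * jb v ^ (2 : ℝ)))
    (hci : ∀ i ∈ Finset.range 3,
      Integrable (fun v : V d => jb v ^ (k - (i : ℝ)) * cCoef d (γ + (i : ℝ)) f v * f v ^ p))
    (hctr : Integrable (fun v : V d => jb v ^ k * cConvTrunc d γ f v * f v ^ p))
    (hLp : Integrable (fun v : V d => jb v ^ k * f v ^ p)) :
    -(∑ i ∈ Finset.range 3,
        ∫ v : V d, jb v ^ (k - (i : ℝ)) * cCoef d (γ + (i : ℝ)) f v * f v ^ p)
      ≤ -(3 * (γ + (d : ℝ) + 2) / (γ + d))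
          * (∫ v : V d, jb v ^ k * cConvTrunc d γ f v * f v ^ p)
        + (3 * ((d : ℝ) - 1) * (γ + d + 2) * ∫ v : V d, f v * jb v ^ (2 : ℝ))
          * ∫ v : V d, jb v ^ k * f v ^ p := by
  have hd1 : 1 ≤ d := by omega
  have hf : Integrable f := by
    refine hL12.mono' hmeas.aestronglyMeasurable (Filter.Eventually.of_forall fun v => ?_)
    rw [Real.norm_of_nonneg (hnn v)]
    exact le_mul_of_one_le_right (hnn v) (Real.one_le_rpow (one_le_jb v) (by norm_num))
  have hae := ae_integrableOn_norm_sub_rpow_mul hd1 hγ₁ hf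
  have key : ∀ i ∈ Finset.range 3,
      -(∫ v : V d, jb v ^ (k - (i : ℝ)) * cCoef d (γ + (i : ℝ)) f v * f v ^ p) ≤
        -((γ + d + 2) / (γ + d)) * (∫ v : V d, jb v ^ k * cConvTrunc d γ f v * f v ^ p)
        + (((d : ℝ) - 1) * (γ + d + 2) * ∫ v : V d, f v * jb v ^ (2 : ℝ))
          * ∫ v : V d, jb v ^ k * f v ^ p := by
    intro i hi
    rw [← integral_neg, ← integral_const_mul, ← integral_const_mul,
      ← integral_add (hctr.const_mul _) (hLp.const_mul _)]
    refine integral_mono_ae (hci i hi).neg ((hctr.const_mul _).add (hLp.const_mul _)) ?_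
    filter_upwards [hae] with v hv
    exact neg_weighted_cCoef_le hd1 hγ₁ hγ₂ k p (by simpa [Nat.lt_succ_iff] using hi) hnn hL12 hv
  rw [← Finset.sum_neg_distrib]
  refine (Finset.sum_le_sum key).trans (le_of_eq ?_)
  rw [Finset.sum_const, Finset.card_range, nsmul_eq_mul]
  push_cast
  ring
end
end
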